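/- For every integer N ≥ 1 and every s ∈ ℝ, ∫_{ℝ^N} (∑_{m=1}^N e^{s λ_m}) · Δ(λ)² · e^{−∑_i λ_i²} dλ = e^{s²/4} · (∑_{j=0}^{N−1} ∑_{k=0}^{j} (binomial j k) · (s²/2)^k / k!) · ∫_{ℝ^N} Δ(λ)² · e^{−∑_i λ_i²} dλ. Equivalently, the normalized expectation of (1/N)∑_m e^{sλ_m} in the Gaussian matrix model with weight e^{−∑_i λ_i²} equals (1/N) e^{s²/4} L^{(1)}_{N−1}(−s²/2), the exact finite-N value of the circular Wilson loop in the localized matrix model. -/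

import Mathlib

open MeasureTheory

namespace GaussianMatrixModel

open Polynomial

/-! ### Monic orthogonal polynomials of the weight `exp (-x ^ 2)` -/

/-- The raising operator sending `p` to `X * p` minus half the derivative of `p`. -/
noncomputable def raising : Module.End ℝ ℝ[X] :=
  LinearMap.mulLeft ℝ X - (1 / 2 : ℝ) • derivative

/-- The monic Hermite polynomials, orthogonal for the weight `exp (-x ^ 2)`. -/
noncomputable def monicHermite (n : ℕ) : ℝ[X] := (raising ^ n) 1

lemma raising_apply (p : ℝ[X]) : raising p = X * p - (1 / 2 : ℝ) • derivative p := rfl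

@[simp] lemma monicHermite_zero : monicHermite 0 = 1 := by simp [monicHermite]

lemma monicHermite_succ (n : ℕ) : monicHermite (n + 1) =
    X * monicHermite n - (1 / 2 : ℝ) • derivative (monicHermite n) := by
  rw [monicHermite, pow_succ', Module.End.mul_apply, raising_apply, monicHermite]

lemma derivative_monicHermite_succ (n : ℕ) :
    derivative (monicHermite (n + 1)) = ((n : ℝ) + 1) • monicHermite n := by
  induction n with
  | zero => simp [monicHermite_succ]
  | succ n ih =>
    rw [monicHermite_succ (n + 1), derivative_sub, derivative_mul, derivative_X, derivative_smul,
      ih, derivative_smul, one_mul, mul_smul_comm, smul_comm (1 / 2 : ℝ), add_sub_assoc,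
      ← smul_sub, ← monicHermite_succ]
    push_cast
    module

lemma monicHermite_monic_natDegree (n : ℕ) :
    (monicHermite n).Monic ∧ (monicHermite n).natDegree = n := by
  induction n with
  | zero => simp
  | succ n ih =>
    obtain ⟨hm, hd⟩ := ih
    have hX : (X * monicHermite n).Monic := monic_X.mul hm
    have hXd : (X * monicHermite n).natDegree = n + 1 := by
      rw [monic_X.natDegree_mul hm, natDegree_X, hd, add_comm]
    have hlt : ((1 / 2 : ℝ) • derivative (monicHermite n)).degree
        < (X * monicHermite n).degree := by
      refine (degree_smul_le _ _).trans_lt (degree_derivative_le.trans_lt ?_)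
      rw [degree_eq_natDegree hm.ne_zero, degree_eq_natDegree hX.ne_zero, hd, hXd]
      exact_mod_cast Nat.lt_succ_self n
    rw [monicHermite_succ]
    exact ⟨hX.sub_of_left hlt, by
      rw [natDegree_eq_of_degree_eq (degree_sub_eq_left_of_degree_lt hlt), hXd]⟩

lemma taylor_raising (c : ℝ) (p : ℝ[X]) :
    taylor c (raising p) = (raising + c • (1 : Module.End ℝ ℝ[X])) (taylor c p) := by
  have hd : taylor c (derivative p) = derivative (taylor c p) := by
    simp [taylor_apply, derivative_comp]
  rw [LinearMap.add_apply, raising_apply, raising_apply, map_sub, taylor_mul, taylor_X, map_smul,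
    hd, LinearMap.smul_apply, Module.End.one_apply, smul_eq_C_mul c]
  ring

/-- The addition formula for the monic Hermite polynomials. -/
lemma monicHermite_eval_add (n : ℕ) (x c : ℝ) : (monicHermite n).eval (x + c) =
    ∑ k ∈ Finset.range (n + 1), (n.choose k : ℝ) * c ^ (n - k) * (monicHermite k).eval x := by
  have h : taylor c (monicHermite n) = ((raising + c • (1 : Module.End ℝ ℝ[X])) ^ n) 1 := by
    induction n with
    | zero => simp
    | succ n ih =>
      rw [pow_succ', Module.End.mul_apply, ← ih, ← taylor_raising]
      simp only [monicHermite, pow_succ', Module.End.mul_apply]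
  rw [← taylor_eval, h, ((Commute.one_right raising).smul_right c).add_pow, LinearMap.sum_apply,
    eval_finsetSum]
  refine Finset.sum_congr rfl fun k _ => ?_
  rw [_root_.smul_pow, one_pow, mul_smul_comm, mul_one, ← nsmul_eq_mul', LinearMap.smul_apply,
    LinearMap.smul_apply, ← monicHermite, eval_smul, eval_smul, nsmul_eq_mul, smul_eq_mul,
    mul_assoc]

/-! ### One-dimensional Gaussian integrals -/

lemma integrable_eval_mul_gaussian (p : ℝ[X]) :
    Integrable fun x : ℝ => p.eval x * Real.exp (-x ^ 2) := by
  induction p using Polynomial.induction_on' with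
  | add p q hp hq =>
    simp_rw [eval_add, add_mul]
    exact hp.add hq
  | monomial n a =>
    have h := (integrable_rpow_mul_exp_neg_mul_sq one_pos
      (neg_one_lt_zero.trans_le (Nat.cast_nonneg n))).const_mul a
    simpa [mul_assoc] using h

lemma integral_eval_mul_monicHermite_succ (q : ℝ[X]) (n : ℕ) :
    ∫ x : ℝ, (q * monicHermite (n + 1)).eval x * Real.exp (-x ^ 2) =
      1 / 2 * ∫ x : ℝ, (derivative q * monicHermite n).eval x * Real.exp (-x ^ 2) := by
  have h := integral_eq_zero_of_hasDerivAt_of_integrable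
    (f := fun x : ℝ => (q * monicHermite n).eval x * Real.exp (-x ^ 2))
    (f' := fun x : ℝ => (derivative q * monicHermite n).eval x * Real.exp (-x ^ 2) -
      2 * ((q * monicHermite (n + 1)).eval x * Real.exp (-x ^ 2))) (fun x => by
        convert! ((q * monicHermite n).hasDerivAt x).mul
          (((hasDerivAt_id x).pow 2).neg.exp) using 1
        simp [monicHermite_succ]
        ring)
    ((integrable_eval_mul_gaussian _).sub ((integrable_eval_mul_gaussian _).const_mul 2))
    (integrable_eval_mul_gaussian _)
  rw [integral_sub (integrable_eval_mul_gaussian _)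
    ((integrable_eval_mul_gaussian _).const_mul 2), integral_const_mul] at h
  linarith

/-- The squared norm of the `n`-th monic Hermite polynomial for the weight `exp (-x ^ 2)`. -/
noncomputable def hermiteNormSq (n : ℕ) : ℝ := n.factorial / 2 ^ n * √Real.pi

lemma hermiteNormSq_succ (n : ℕ) :
    hermiteNormSq (n + 1) = 1 / 2 * (((n : ℝ) + 1) * hermiteNormSq n) := by
  simp only [hermiteNormSq, Nat.factorial_succ, pow_succ]
  push_cast
  field_simp

lemma integral_monicHermite_mul (m n : ℕ) :
    ∫ x : ℝ, (monicHermite m * monicHermite n).eval x * Real.exp (-x ^ 2) =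
      if m = n then hermiteNormSq n else 0 := by
  induction n generalizing m with
  | zero =>
    cases m with
    | zero => simpa [hermiteNormSq] using integral_gaussian 1
    | succ m =>
      rw [mul_comm, integral_eval_mul_monicHermite_succ]
      simp
  | succ n ih =>
    rw [integral_eval_mul_monicHermite_succ]
    cases m with
    | zero => simp
    | succ m =>
      simp_rw [derivative_monicHermite_succ, smul_mul_assoc, eval_smul, smul_eq_mul, mul_assoc,
        integral_const_mul, ih]
      by_cases h : m = n
      · simp [h, hermiteNormSq_succ]
      · simp [h]

lemma exp_mul_eval_mul_gaussian (s : ℝ) (p : ℝ[X]) (x : ℝ) :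
    p.eval x * Real.exp (-x ^ 2) * Real.exp (s * x) = Real.exp (s ^ 2 / 4) *
      ((taylor (s / 2) p).eval (x - s / 2) * Real.exp (-(x - s / 2) ^ 2)) := by
  rw [taylor_eval, sub_add_cancel, mul_assoc, ← Real.exp_add, mul_left_comm, ← Real.exp_add]
  ring_nf

lemma integrable_exp_mul_eval_mul_gaussian (s : ℝ) (p : ℝ[X]) :
    Integrable fun x : ℝ => p.eval x * Real.exp (-x ^ 2) * Real.exp (s * x) := by
  simp_rw [exp_mul_eval_mul_gaussian]
  exact ((integrable_eval_mul_gaussian _).comp_sub_right (s / 2)).const_mul _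

lemma integral_taylor_monicHermite_sq (n : ℕ) (c : ℝ) :
    ∫ x : ℝ, (taylor c (monicHermite n * monicHermite n)).eval x * Real.exp (-x ^ 2) =
      ∑ k ∈ Finset.range (n + 1), ((n.choose k : ℝ) * c ^ (n - k)) ^ 2 * hermiteNormSq k := by
  have h (x : ℝ) : (taylor c (monicHermite n * monicHermite n)).eval x * Real.exp (-x ^ 2) =
      ∑ k ∈ Finset.range (n + 1), ∑ l ∈ Finset.range (n + 1),
        ((n.choose k : ℝ) * c ^ (n - k)) * ((n.choose l : ℝ) * c ^ (n - l)) *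
          ((monicHermite k * monicHermite l).eval x * Real.exp (-x ^ 2)) := by
    rw [taylor_eval, eval_mul, monicHermite_eval_add, Finset.sum_mul_sum, Finset.sum_mul]
    refine Finset.sum_congr rfl fun k _ => ?_
    rw [Finset.sum_mul]
    refine Finset.sum_congr rfl fun l _ => ?_
    rw [eval_mul]
    ring
  simp_rw [h]
  rw [integral_finsetSum _ fun k _ => integrable_finsetSum _ fun l _ =>
    (integrable_eval_mul_gaussian _).const_mul _]
  refine Finset.sum_congr rfl fun k hk => ?_
  rw [integral_finsetSum _ fun l _ => (integrable_eval_mul_gaussian _).const_mul _]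
  simp_rw [integral_const_mul, integral_monicHermite_mul, mul_ite, mul_zero]
  rw [Finset.sum_ite_eq, if_pos hk, sq]

/-- The Gaussian integral of `exp (s x)` against a squared monic Hermite polynomial is a Laguerre
polynomial in `-s ^ 2 / 2`. -/
lemma integral_exp_mul_monicHermite_sq (n : ℕ) (s : ℝ) :
    ∫ x : ℝ, (monicHermite n * monicHermite n).eval x * Real.exp (-x ^ 2) * Real.exp (s * x) =
      hermiteNormSq n * (Real.exp (s ^ 2 / 4) * ∑ k ∈ Finset.range (n + 1),
        (n.choose k : ℝ) * (s ^ 2 / 2) ^ k / (k.factorial : ℝ)) := by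
  simp_rw [exp_mul_eval_mul_gaussian]
  rw [integral_const_mul, integral_sub_right_eq_self (fun x : ℝ =>
    (taylor (s / 2) (monicHermite n * monicHermite n)).eval x * Real.exp (-x ^ 2)) (s / 2),
    integral_taylor_monicHermite_sq, mul_left_comm, ← Finset.sum_range_reflect]
  congr 1
  rw [Finset.mul_sum]
  refine Finset.sum_congr rfl fun k hk => ?_
  have hk : k ≤ n := Nat.lt_succ_iff.1 (Finset.mem_range.1 hk)
  obtain ⟨m, rfl⟩ := Nat.exists_eq_add_of_le hk
  have h1 : k + m + 1 - 1 - k = m := by omega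
  have h2 : k + m - m = k := by omega
  have h3 : ((k + m).choose m : ℝ) = (k + m).choose k := by
    exact_mod_cast (Nat.choose_symm_add (a := k) (b := m)).symm
  have h4 : ((k + m).factorial : ℝ) = (k + m).choose k * k.factorial * m.factorial := by
    rw [← h3]
    exact_mod_cast (Nat.add_choose_mul_factorial_mul_factorial k m).symm
  rw [h1, h2, h3, hermiteNormSq, hermiteNormSq, h4, show s ^ 2 / 2 = (s / 2) ^ 2 * 2 by ring,
    mul_pow, pow_add]
  generalize s / 2 = c
  rw [show (c ^ 2 * 2) ^ k = (c ^ k) ^ 2 * 2 ^ k by rw [mul_pow, pow_right_comm]]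
  field_simp

/-! ### Linear statistics of determinantal ensembles -/

/-- For functions `φ i` orthogonal with respect to the weight `w`, the integral of a linear
statistic against `det (φ j (l i)) ^ 2 ∏ w (l i)`. -/
lemma integral_sum_mul_det_sq {ι : Type*} [Fintype ι] [DecidableEq ι] (φ : ι → ℝ → ℝ)
    (w g : ℝ → ℝ) (h a : ι → ℝ)
    (hint : ∀ i j, Integrable fun x => φ i x * φ j x * w x)
    (hintg : ∀ i j, Integrable fun x => φ i x * φ j x * w x * g x)
    (horth : ∀ i j, ∫ x, φ i x * φ j x * w x = if i = j then h j else 0)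
    (hg : ∀ i, ∫ x, φ i x * φ i x * w x * g x = h i * a i) :
    ∫ l : ι → ℝ, (∑ m, g (l m)) * ((Matrix.of fun i j => φ j (l i)).det ^ 2 * ∏ i, w (l i)) =
      (Fintype.card ι).factorial * (∏ i, h i) * ∑ i, a i := by
  let F (m : ι) (σ τ : Equiv.Perm ι) (i : ι) (x : ℝ) : ℝ :=
    φ (σ i) x * φ (τ i) x * w x * (if i = m then g x else 1)
  have hF (m : ι) (σ τ : Equiv.Perm ι) (i : ι) : Integrable (F m σ τ i) := by
    by_cases him : i = m
    · simpa [F, him] using hintg (σ m) (τ m)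
    · simpa [F, him] using hint (σ i) (τ i)
  have hprod (m : ι) (σ τ : Equiv.Perm ι) :
      Integrable fun l : ι → ℝ => ∏ i, F m σ τ i (l i) := Integrable.fintype_prod (hF m σ τ)
  have hexp (l : ι → ℝ) :
      (∑ m, g (l m)) * ((Matrix.of fun i j => φ j (l i)).det ^ 2 * ∏ i, w (l i)) =
        ∑ m, ∑ σ : Equiv.Perm ι, ∑ τ : Equiv.Perm ι,
          ((σ.sign : ℤ) : ℝ) * ((τ.sign : ℤ) : ℝ) * ∏ i, F m σ τ i (l i) := by
    rw [← Matrix.det_transpose, Matrix.det_apply', sq, Finset.sum_mul_sum, Finset.sum_mul]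
    refine Finset.sum_congr rfl fun m _ => ?_
    rw [Finset.sum_mul, Finset.mul_sum]
    refine Finset.sum_congr rfl fun σ _ => ?_
    rw [Finset.sum_mul, Finset.mul_sum]
    refine Finset.sum_congr rfl fun τ _ => ?_
    simp only [F, Finset.prod_mul_distrib, Finset.prod_ite_eq', Finset.mem_univ, if_true,
      Matrix.transpose_apply, Matrix.of_apply]
    ring
  have hval (m : ι) (σ τ : Equiv.Perm ι) :
      ∏ i, ∫ x, F m σ τ i x = if σ = τ then (∏ i, h i) * a (σ m) else 0 := by
    split_ifs with hστ
    · subst hστ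
      have hi (i : ι) : ∫ x, F m σ σ i x = h (σ i) * if i = m then a (σ i) else 1 := by
        by_cases him : i = m
        · simpa [F, him] using hg (σ m)
        · simpa [F, him] using horth (σ i) (σ i)
      simp_rw [hi, Finset.prod_mul_distrib, Finset.prod_ite_eq', Finset.mem_univ, if_true,
        Equiv.prod_comp σ h]
    · obtain ⟨i, him, hi⟩ : ∃ i, i ≠ m ∧ σ i ≠ τ i := by
        by_contra! hcon
        refine hστ (Equiv.ext fun i => ?_)
        by_cases him : i = m
        · subst him
          have hfix (j : ι) (hj : j ≠ i) : (τ⁻¹ * σ) j = j := by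
            simp [hcon j hj]
          have : (τ⁻¹ * σ) i = i := by
            by_contra hne
            exact hne ((τ⁻¹ * σ).injective (hfix _ hne))
          exact (Equiv.Perm.inv_eq_iff_eq.1 this)
        · exact hcon i him
      refine Finset.prod_eq_zero (Finset.mem_univ i) ?_
      simpa [F, him, hi] using horth (σ i) (τ i)
  simp_rw [hexp]
  rw [integral_finsetSum _ fun m _ => integrable_finsetSum _ fun σ _ =>
    integrable_finsetSum _ fun τ _ => (hprod m σ τ).const_mul _]
  have hm (m : ι) : ∫ l : ι → ℝ, ∑ σ : Equiv.Perm ι, ∑ τ : Equiv.Perm ι,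
      ((σ.sign : ℤ) : ℝ) * ((τ.sign : ℤ) : ℝ) * ∏ i, F m σ τ i (l i) =
        ∑ σ : Equiv.Perm ι, (∏ i, h i) * a (σ m) := by
    rw [integral_finsetSum _ fun σ _ =>
      integrable_finsetSum _ fun τ _ => (hprod m σ τ).const_mul _]
    refine Finset.sum_congr rfl fun σ _ => ?_
    rw [integral_finsetSum _ fun τ _ => (hprod m σ τ).const_mul _]
    simp_rw [integral_const_mul, integral_fintype_prod_volume_eq_prod, hval, mul_ite, mul_zero]
    rw [Finset.sum_ite_eq, if_pos (Finset.mem_univ σ), ← Int.cast_mul, ← Units.val_mul,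
      Int.units_mul_self, Units.val_one, Int.cast_one, one_mul]
  simp_rw [hm]
  rw [Finset.sum_comm]
  simp_rw [← Finset.mul_sum, Equiv.sum_comp _ a]
  rw [Finset.sum_const, Finset.card_univ, Fintype.card_perm, nsmul_eq_mul]
  ring

lemma vandermonde_sq_mul_gaussian (N : ℕ) (l : Fin N → ℝ) :
    (∏ i : Fin N, ∏ j ∈ Finset.Ioi i, (l i - l j) ^ 2) * Real.exp (-∑ i, l i ^ 2) =
      (Matrix.of fun i j : Fin N => (monicHermite j).eval (l i)).det ^ 2 *
        ∏ i, Real.exp (-l i ^ 2) := by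
  rw [← Matrix.det_eval_matrixOfPolynomials_eq_det_vandermonde l (fun j => monicHermite j)
    (fun j => (monicHermite_monic_natDegree j).2) (fun j => (monicHermite_monic_natDegree j).1),
    Matrix.det_vandermonde, ← Real.exp_sum, Finset.sum_neg_distrib, ← Finset.prod_pow]
  simp_rw [← Finset.prod_pow, sub_sq_comm]

end GaussianMatrixModel

/-- The exact finite-N circular Wilson loop of the Gaussian matrix model:
`∫ (∑ₘ e^{sλₘ}) Δ(λ)² e^{-∑λᵢ²} dλ
  = e^{s²/4} (∑_{j=0}^{N-1} ∑_{k=0}^{j} (j choose k)(s²/2)^k/k!) ∫ Δ(λ)² e^{-∑λᵢ²} dλ`,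
i.e. the normalized expectation of `(1/N)∑ₘ e^{sλₘ}` equals `(1/N) e^{s²/4} L⁽¹⁾_{N-1}(-s²/2)`. -/
theorem gaussian_matrix_model_wilson_loop (N : ℕ) (hN : 1 ≤ N) (s : ℝ) :
    ∫ l : Fin N → ℝ,
        (∑ m : Fin N, Real.exp (s * l m)) *
          ((∏ i : Fin N, ∏ j ∈ Finset.Ioi i, (l i - l j) ^ 2) * Real.exp (-∑ i, l i ^ 2))
      = Real.exp (s ^ 2 / 4) *
          (∑ j ∈ Finset.range N, ∑ k ∈ Finset.range (j + 1),
            (j.choose k : ℝ) * (s ^ 2 / 2) ^ k / (k.factorial : ℝ)) *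
          ∫ l : Fin N → ℝ,
            (∏ i : Fin N, ∏ j ∈ Finset.Ioi i, (l i - l j) ^ 2) * Real.exp (-∑ i, l i ^ 2) := by
  open GaussianMatrixModel in
  have key (g : ℝ → ℝ) (a : Fin N → ℝ)
      (hintg : ∀ p : Polynomial ℝ, Integrable fun x => p.eval x * Real.exp (-x ^ 2) * g x)
      (hg : ∀ i : Fin N, ∫ x, (monicHermite i * monicHermite i).eval x * Real.exp (-x ^ 2) * g x =
        hermiteNormSq i * a i) :=
    integral_sum_mul_det_sq (fun (i : Fin N) x => (monicHermite i).eval x)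
      (fun x => Real.exp (-x ^ 2)) g (fun i => hermiteNormSq i) a
      (fun i j => by simpa only [Polynomial.eval_mul] using
        integrable_eval_mul_gaussian (monicHermite i * monicHermite j))
      (fun i j => by
        have h := hintg (monicHermite i * monicHermite j)
        simpa only [Polynomial.eval_mul] using h)
      (fun i j => by simpa only [Polynomial.eval_mul, Fin.ext_iff] using
        integral_monicHermite_mul i j)
      (fun i => by simpa only [Polynomial.eval_mul] using hg i)
  have hexp := key (fun x => Real.exp (s * x)) _
    (GaussianMatrixModel.integrable_exp_mul_eval_mul_gaussian s)
    (fun i => GaussianMatrixModel.integral_exp_mul_monicHermite_sq i s)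
  have hone := key (fun _ => 1) (fun _ => 1)
    (fun p => by simpa using GaussianMatrixModel.integrable_eval_mul_gaussian p)
    (fun i => by simpa using GaussianMatrixModel.integral_monicHermite_mul i i)
  have hN' : (N : ℝ) ≠ 0 := by exact_mod_cast (Nat.one_le_iff_ne_zero.1 hN)
  simp only [Finset.sum_const, Finset.card_univ, Fintype.card_fin, nsmul_eq_mul, mul_one,
    integral_const_mul] at hone
  rw [mul_comm _ (N : ℝ)] at hone
  simp_rw [GaussianMatrixModel.vandermonde_sq_mul_gaussian]
  rw [hexp, mul_left_cancel₀ hN' hone, ← Finset.mul_sum, Fintype.card_fin,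
    Fin.sum_univ_eq_sum_range (fun j => ∑ k ∈ Finset.range (j + 1),
      (j.choose k : ℝ) * (s ^ 2 / 2) ^ k / (k.factorial : ℝ)) N]
  ring
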